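/- Let y_i ∈ K[[x]] satisfy q_i·y_i' = p_i·y_i with p_i, q_i ∈ K[x] of degree at most d and q_i(0) ≠ 0, for 1 ≤ i ≤ n, and let c_i ∈ K, g_i ∈ K[x] of degree at most d. If S = Σ_{i=1}^n c_i g_i y_i is nonzero, then ord(S) ≤ Σ_{i=1}^n ord(y_i) + n²d + n - 1. -/

import Mathlib

open PowerSeries

namespace WronskAux

variable {K : Type*} [Field K]

theorem natDegree_det_le {m : ℕ} (e : ℕ) (R : Matrix (Fin m) (Fin m) (Polynomial K))
    (h : ∀ i j, (R i j).natDegree ≤ e) : R.det.natDegree ≤ m * e := by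
  rw [Matrix.det_apply]
  refine Polynomial.natDegree_sum_le_of_forall_le _ _ ?_
  intro s _
  have h1 : (∏ i, R (s i) i).natDegree ≤ m * e := by
    refine (Polynomial.natDegree_prod_le _ _).trans ?_
    refine (Finset.sum_le_sum (fun i _ => h (s i) i)).trans ?_
    simp
  rcases Int.units_eq_one_or (Equiv.Perm.sign s) with hs | hs <;> simp [hs, h1]

theorem X_pow_dvd_deriv {k : ℕ} {f : K⟦X⟧} (h : (X : K⟦X⟧) ^ (k + 1) ∣ f) :
    (X : K⟦X⟧) ^ k ∣ d⁄dX K f := by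
  rw [X_pow_dvd_iff] at h ⊢
  intro i hi
  rw [coeff_derivative, h (i + 1) (by omega), zero_mul]

theorem X_pow_dvd_iter {N : ℕ} {f : K⟦X⟧} (h : (X : K⟦X⟧) ^ N ∣ f) (j : ℕ) :
    (X : K⟦X⟧) ^ (N - j) ∣ (d⁄dX K)^[j] f := by
  induction j with
  | zero => simpa using h
  | succ j ih =>
    rw [Function.iterate_succ_apply']
    by_cases hj : N ≤ j
    · have : N - (j + 1) = 0 := by omega
      simp [this]
    · apply X_pow_dvd_deriv
      have : N - (j + 1) + 1 = N - j := by omega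
      rwa [this]

/-- Power series with the same logarithmic derivative have the same order. -/
theorem coeff_ne_of_logDeriv [CharZero K] {f h : K⟦X⟧} (hh : h ≠ 0) (hf : f ≠ 0)
    (H : h * d⁄dX K f = d⁄dX K h * f) : f.order = h.order := by
  obtain ⟨a, u, hu, rfl⟩ : ∃ (a : ℕ) (u : K⟦X⟧), constantCoeff u ≠ 0 ∧ f = X ^ a * u := by
    refine ⟨f.order.toNat, divXPowOrder f, ?_, (X_pow_order_mul_divXPowOrder).symm⟩
    rw [constantCoeff_divXPowOrder]
    exact coeff_order hf
  obtain ⟨b, v, hv, rfl⟩ : ∃ (a : ℕ) (u : K⟦X⟧), constantCoeff u ≠ 0 ∧ h = X ^ a * u := by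
    refine ⟨h.order.toNat, divXPowOrder h, ?_, (X_pow_order_mul_divXPowOrder).symm⟩
    rw [constantCoeff_divXPowOrder]
    exact coeff_order hh
  have key : ∀ (a : ℕ) (u : K⟦X⟧), X * d⁄dX K (X ^ a * u)
      = X ^ a * ((a : K⟦X⟧) * u + X * d⁄dX K u) := by
    intro a u
    cases a with
    | zero => simp
    | succ a =>
      simp [Derivation.leibniz, Derivation.leibniz_pow, derivative_X]
      ring
  have h2 : (X ^ (a + b) : K⟦X⟧) * (v * ((a : K⟦X⟧) * u + X * d⁄dX K u)
      - u * ((b : K⟦X⟧) * v + X * d⁄dX K v)) = 0 := by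
    linear_combination X * H - X ^ b * v * key a u + X ^ a * u * key b v
  have h3 := (mul_eq_zero.mp h2).resolve_left (pow_ne_zero _ X_ne_zero)
  have h4 := congrArg constantCoeff h3
  simp only [map_sub, map_mul, map_add, map_natCast, constantCoeff_X, zero_mul, add_zero,
    map_zero] at h4
  have h5 : ((a : K) - b) * (constantCoeff u * constantCoeff v) = 0 := by linear_combination h4
  have h6 := (mul_eq_zero.mp h5).resolve_right (mul_ne_zero hu hv)
  have h7 : a = b := by exact_mod_cast sub_eq_zero.mp h6
  have o0 : ∀ w : K⟦X⟧, constantCoeff w ≠ 0 → w.order = 0 := by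
    intro w hw
    exact order_zero_of_unit (isUnit_iff_constantCoeff.mpr hw.isUnit)
  rw [order_mul, order_mul, o0 u hu, o0 v hv, h7]

theorem const_mul_of_logDeriv [CharZero K] {f h : K⟦X⟧} (hh : h ≠ 0)
    (H : h * d⁄dX K f = d⁄dX K h * f) : ∃ c : K, f = c • h := by
  set e := h.order.toNat with he
  have hc : coeff e h ≠ 0 := coeff_order hh
  refine ⟨coeff e f / coeff e h, ?_⟩
  by_contra hne
  have h0 : f - (coeff e f / coeff e h) • h ≠ 0 := sub_ne_zero.mpr hne
  have := coeff_ne_of_logDeriv hh h0 (by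
    rw [map_sub, Derivation.map_smul, smul_eq_C_mul, smul_eq_C_mul]
    linear_combination H)
  have h1 := coeff_order h0
  rw [this, ← he] at h1
  apply h1
  simp [hc]

theorem wronskian_ne_zero [CharZero K] {m : ℕ} (z : Fin m → K⟦X⟧) (hz : LinearIndependent K z) :
    (Matrix.of fun j i : Fin m => (d⁄dX K)^[(j : ℕ)] (z i)).det ≠ 0 := by
  induction m with
  | zero => simp
  | succ m ih =>
    have ih' := ih (fun i => z i.castSucc) (hz.comp _ (Fin.castSucc_injective m))
    intro hdet
    obtain ⟨f, hf0, hf⟩ := Matrix.exists_mulVec_eq_zero_iff.mpr hdet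
    have hrel : ∀ j : ℕ, j ≤ m → ∑ i, (d⁄dX K)^[j] (z i) * f i = 0 := by
      intro j hj
      have := congrFun hf ⟨j, by omega⟩
      simpa [Matrix.mulVec, dotProduct] using this
    have huniq : ∀ w : Fin m → K⟦X⟧,
        (∀ j : ℕ, j < m → ∑ i, (d⁄dX K)^[j] (z (Fin.castSucc i)) * w i = 0) → w = 0 := by
      intro w hw
      refine Matrix.eq_zero_of_mulVec_eq_zero ih' ?_
      funext j
      simpa [Matrix.mulVec, dotProduct] using hw j j.2
    set h := f (Fin.last m) with hh
    have hh0 : h ≠ 0 := by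
      intro h0
      apply hf0
      have := huniq (fun i => f i.castSucc) (by
        intro j hj
        have := hrel j hj.le
        rw [Fin.sum_univ_castSucc, ← hh, h0, mul_zero, add_zero] at this
        exact this)
      funext i
      refine Fin.lastCases ?_ (fun i => ?_) i
      · exact h0
      · exact congrFun this i
    have hder : ∀ j : ℕ, j < m → ∑ i, (d⁄dX K)^[j] (z i) * d⁄dX K (f i) = 0 := by
      intro j hj
      have h1 := congrArg (d⁄dX K) (hrel j hj.le)
      have h2 := hrel (j + 1) hj
      simp only [map_sum, Derivation.leibniz, map_zero, smul_eq_mul, Finset.sum_add_distrib] at h1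
      simp only [Function.iterate_succ_apply'] at h2
      rw [← h1, left_eq_add, ← h2]
      exact Finset.sum_congr rfl fun i _ => mul_comm _ _
    have hw := huniq (fun i => h * d⁄dX K (f i.castSucc) - d⁄dX K h * f i.castSucc) (by
      intro j hj
      have h1 := hder j hj
      have h2 := hrel j hj.le
      rw [Fin.sum_univ_castSucc, ← hh] at h1 h2
      have : ∑ i : Fin m, (d⁄dX K)^[j] (z (Fin.castSucc i)) *
          (h * d⁄dX K (f i.castSucc) - d⁄dX K h * f i.castSucc) =
          h * ∑ i : Fin m, (d⁄dX K)^[j] (z (Fin.castSucc i)) * d⁄dX K (f i.castSucc)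
          - d⁄dX K h * ∑ i : Fin m, (d⁄dX K)^[j] (z (Fin.castSucc i)) * f i.castSucc := by
        rw [Finset.mul_sum, Finset.mul_sum, ← Finset.sum_sub_distrib]
        exact Finset.sum_congr rfl fun i _ => by ring
      rw [this]
      linear_combination h * h1 - d⁄dX K h * h2)
    have hconst : ∀ i, ∃ c : K, f i = c • h := by
      intro i
      refine Fin.lastCases ?_ (fun i => ?_) i
      · exact ⟨1, by simp [hh]⟩
      · exact const_mul_of_logDeriv hh0 (sub_eq_zero.mp (congrFun hw i))
    choose a ha using hconst
    have h0 := hrel 0 (Nat.zero_le _)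
    have h1 : h * ∑ i, a i • z i = 0 := by
      rw [← h0, Finset.mul_sum]
      refine Finset.sum_congr rfl fun i _ => ?_
      rw [ha i]
      simp [mul_comm]
    have h2 := Fintype.linearIndependent_iff.mp hz a ((mul_eq_zero.mp h1).resolve_left hh0)
      (Fin.last m)
    apply hh0
    rw [hh, ha, h2, zero_smul]

theorem exists_poly {d : ℕ} (y : K⟦X⟧) (p q g : Polynomial K)
    (hode : ((q : K⟦X⟧) * d⁄dX K y) = (p : K⟦X⟧) * y)
    (hp : p.natDegree ≤ d) (hq : q.natDegree ≤ d) (hg : g.natDegree ≤ d) (j : ℕ) :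
    ∃ r : Polynomial K, r.natDegree ≤ (j + 1) * d ∧
      (q : K⟦X⟧) ^ j * (d⁄dX K)^[j] ((g : K⟦X⟧) * y) = (r : K⟦X⟧) * y := by
  induction j with
  | zero => exact ⟨g, by simpa using hg, by simp⟩
  | succ j ih =>
    obtain ⟨r, hr, hrel⟩ := ih
    refine ⟨q * Polynomial.derivative r + (p - (j : Polynomial K) * Polynomial.derivative q) * r,
      ?_, ?_⟩
    · have e : (j + 1 + 1) * d = d + (j + 1) * d := by ring
      rw [e]
      refine Polynomial.natDegree_add_le_of_degree_le ?_ ?_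
      · exact Polynomial.natDegree_mul_le_of_le hq
          ((Polynomial.natDegree_derivative_le r).trans (by omega))
      · refine Polynomial.natDegree_mul_le_of_le ?_ hr
        refine (Polynomial.natDegree_sub_le_of_le hp (n := d) ?_).trans (by simp)
        refine (Polynomial.natDegree_mul_le_of_le (m := 0) (n := d) (by simp)
          ((Polynomial.natDegree_derivative_le q).trans (by omega))).trans (by simp)
    · rw [Function.iterate_succ_apply']
      set w := (d⁄dX K)^[j] ((g : K⟦X⟧) * y)
      have h1 := congrArg (d⁄dX K) hrel
      simp only [Derivation.leibniz, smul_eq_mul, derivative_coe] at h1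
      have h2 : (q : K⟦X⟧) * d⁄dX K ((q : K⟦X⟧) ^ j)
          = (j : K⟦X⟧) * (q : K⟦X⟧) ^ j * (Polynomial.derivative q : Polynomial K) := by
        cases j with
        | zero => simp
        | succ j =>
          simp [Derivation.leibniz_pow, derivative_coe]
          ring
      have h3 : (((j : Polynomial K)) : K⟦X⟧) = (j : K⟦X⟧) := by
        exact map_natCast (Polynomial.coeToPowerSeries.ringHom (R := K)) j
      simp only [Polynomial.coe_add, Polynomial.coe_mul, Polynomial.coe_sub, h3]
      linear_combination (q : K⟦X⟧) * h1 - w * h2 + (r : K⟦X⟧) * hode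
        - (j : K⟦X⟧) * (Polynomial.derivative q : Polynomial K) * hrel

theorem core [CharZero K] {m d : ℕ}
    (y : Fin m → K⟦X⟧) (p q g : Fin m → Polynomial K) (a : Fin m → K)
    (hode : ∀ i, ((q i : K⟦X⟧) * d⁄dX K (y i)) = (p i : K⟦X⟧) * y i)
    (hp : ∀ i, (p i).natDegree ≤ d) (hq : ∀ i, (q i).natDegree ≤ d)
    (hq0 : ∀ i, (q i).eval 0 ≠ 0) (hg : ∀ i, (g i).natDegree ≤ d)
    (hz : LinearIndependent K fun i => (g i : K⟦X⟧) * y i)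
    (S : K⟦X⟧) (hS : S = ∑ i, a i • ((g i : K⟦X⟧) * y i)) (hS0 : S ≠ 0) :
    0 < m ∧ S.order ≤ (∑ i, (y i).order) + (m ^ 2 * d + (m - 1) : ℕ) := by
  obtain ⟨i₀, hi₀⟩ : ∃ i, a i ≠ 0 := by
    by_contra! hcon
    exact hS0 (by simp [hS, hcon])
  have hm : 0 < m := i₀.pos
  refine ⟨hm, ?_⟩
  set z : Fin m → K⟦X⟧ := fun i => (g i : K⟦X⟧) * y i with hzdef
  have hW := wronskian_ne_zero z hz
  set M : Matrix (Fin m) (Fin m) K⟦X⟧ :=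
    Matrix.of fun j i : Fin m => (d⁄dX K)^[(j : ℕ)] (z i) with hM
  have hSit : ∀ j : ℕ, (d⁄dX K)^[j] S = ∑ i, a i • (d⁄dX K)^[j] (z i) := by
    intro j
    induction j with
    | zero => simpa using hS
    | succ j ih =>
      simp only [Function.iterate_succ_apply', ih, map_sum, Derivation.map_smul]
  set N := S.order.toNat with hN
  have hNo : S.order = (N : ℕ∞) := (ENat.natCast_toNat (by simpa using hS0)).symm
  have hdvdS : (X : K⟦X⟧) ^ N ∣ S := X_pow_order_dvd
  have hMa : M.mulVec (fun i => C (a i)) = fun j : Fin m => (d⁄dX K)^[(j : ℕ)] S := by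
    funext j
    rw [hSit]
    simp only [hM, Matrix.mulVec, dotProduct, Matrix.of_apply, smul_eq_C_mul]
    exact Finset.sum_congr rfl fun i _ => mul_comm _ _
  have hadj : M.det * C (a i₀) = ∑ j, M.adjugate i₀ j * (d⁄dX K)^[(j : ℕ)] S := by
    have h1 := congrArg (fun v => M.adjugate.mulVec v i₀) hMa
    simp only [Matrix.mulVec_mulVec, Matrix.adjugate_mul, Matrix.smul_mulVec,
      Matrix.one_mulVec] at h1
    simpa [Matrix.mulVec, dotProduct] using h1
  have hdvdW : (X : K⟦X⟧) ^ (N - (m - 1)) ∣ M.det := by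
    have h1 : (X : K⟦X⟧) ^ (N - (m - 1)) ∣ M.det * C (a i₀) := by
      rw [hadj]
      refine Finset.dvd_sum fun j _ => Dvd.dvd.mul_left ?_ _
      refine (pow_dvd_pow _ ?_).trans (X_pow_dvd_iter hdvdS (j : ℕ))
      omega
    exact ((hi₀.isUnit.map (C (R := K))).dvd_mul_right).mp h1
  choose r hr hrel using fun (i : Fin m) (j : ℕ) =>
    exists_poly (y i) (p i) (q i) (g i) (hode i) (hp i) (hq i) (hg i) j
  set R : Matrix (Fin m) (Fin m) (Polynomial K) :=
    Matrix.of fun j i : Fin m => q i ^ (m - 1 - (j : ℕ)) * r i j with hR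
  have hRdeg : R.det.natDegree ≤ m ^ 2 * d := by
    have := natDegree_det_le (m * d) R (by
      intro j i
      refine (Polynomial.natDegree_mul_le_of_le
        (Polynomial.natDegree_pow_le_of_le (m - 1 - (j : ℕ)) (hq i)) (hr i j)).trans ?_
      rw [← add_mul]
      refine Nat.mul_le_mul_right _ ?_
      omega)
    refine this.trans (le_of_eq (by ring))
  have hmain : (∏ i, (q i : K⟦X⟧) ^ (m - 1)) * M.det = (∏ i, y i) * (R.det : K⟦X⟧) := by
    have hcoe : (R.det : K⟦X⟧) = (R.map fun x : Polynomial K => (x : K⟦X⟧)).det :=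
      RingHom.map_det (Polynomial.coeToPowerSeries.ringHom (R := K)) R
    rw [hcoe, ← Matrix.det_mul_row, ← Matrix.det_mul_row]
    congr 1
    ext1 j i
    simp only [Matrix.of_apply, hM, hR, Matrix.map_apply, Polynomial.coe_mul, Polynomial.coe_pow]
    have e : m - 1 = (m - 1 - (j : ℕ)) + j := by omega
    have h1 := hrel i j
    rw [show (q i : K⟦X⟧) ^ (m - 1) = (q i : K⟦X⟧) ^ (m - 1 - (j : ℕ)) * (q i : K⟦X⟧) ^ (j : ℕ) by
      rw [← pow_add, ← e]]
    linear_combination (q i : K⟦X⟧) ^ (m - 1 - (j : ℕ)) * h1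
  have hqne : ∀ i, (q i : K⟦X⟧) ≠ 0 := by
    intro i h0
    apply hq0 i
    have : q i = 0 := by exact_mod_cast h0
    simp [this]
  have hRne : R.det ≠ 0 := by
    intro h0
    rw [h0, Polynomial.coe_zero, mul_zero] at hmain
    exact mul_ne_zero (Finset.prod_ne_zero_iff.mpr fun i _ => pow_ne_zero _ (hqne i)) hW hmain
  have hRord : (R.det : K⟦X⟧).order ≤ (m ^ 2 * d : ℕ) := by
    refine (order_le R.det.natDegree ?_).trans (by exact_mod_cast hRdeg)
    rw [Polynomial.coeff_coe]
    simpa using hRne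
  have hk : ((N - (m - 1) : ℕ) : ℕ∞) ≤ ((∏ i, y i) * (R.det : K⟦X⟧)).order := by
    rw [← hmain]
    exact nat_le_order _ _ fun i hi => X_pow_dvd_iff.mp (hdvdW.mul_left _) i hi
  rw [order_mul, order_prod] at hk
  rw [hNo]
  calc (N : ℕ∞) ≤ ((N - (m - 1) + (m - 1) : ℕ) : ℕ∞) := by exact_mod_cast (by omega)
    _ = ((N - (m - 1) : ℕ) : ℕ∞) + ((m - 1 : ℕ) : ℕ∞) := by push_cast; rfl
    _ ≤ (∑ i, (y i).order + ((m ^ 2 * d : ℕ) : ℕ∞)) + ((m - 1 : ℕ) : ℕ∞) := by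
      gcongr
      exact hk.trans (by gcongr)
    _ = _ := by rw [Nat.cast_add, add_assoc]

end WronskAux

theorem order_sum_solutions_first_order_ODE
    {K : Type*} [Field K] [CharZero K] {n d : ℕ}
    (y : Fin n → K⟦X⟧) (p q g : Fin n → Polynomial K) (c : Fin n → K)
    (hy0 : ∀ i, y i ≠ 0)
    (hode : ∀ i, ((q i : K⟦X⟧) * d⁄dX K (y i)) = (p i : K⟦X⟧) * y i)
    (hp : ∀ i, (p i).natDegree ≤ d) (hq : ∀ i, (q i).natDegree ≤ d)
    (hq0 : ∀ i, (q i).eval 0 ≠ 0) (hg : ∀ i, (g i).natDegree ≤ d)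
    (S : K⟦X⟧) (hS : S = ∑ i, c i • ((g i : K⟦X⟧) * y i)) (hS0 : S ≠ 0) :
    S.order ≤ (∑ i, (y i).order) + (n ^ 2 * d + n - 1 : ℕ) := by
  obtain ⟨κ, b, hb, hspan, hli⟩ :=
    exists_linearIndependent' K (fun i => (g i : K⟦X⟧) * y i)
  haveI : Finite κ := Finite.of_injective b hb
  obtain ⟨m, ⟨e⟩⟩ := Finite.exists_equiv_fin κ
  set s : Fin m → Fin n := b ∘ e.symm with hs
  have hsinj : Function.Injective s := hb.comp e.symm.injective
  have hmem : S ∈ Submodule.span K (Set.range ((fun i => (g i : K⟦X⟧) * y i) ∘ s)) := by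
    have : Set.range ((fun i => (g i : K⟦X⟧) * y i) ∘ s)
        = Set.range ((fun i => (g i : K⟦X⟧) * y i) ∘ b) := by
      rw [hs, ← Function.comp_assoc, e.symm.surjective.range_comp]
    rw [this, hspan, hS]
    exact Submodule.sum_mem _ fun i _ => Submodule.smul_mem _ _ (Submodule.subset_span ⟨i, rfl⟩)
  obtain ⟨a, ha⟩ := (Submodule.mem_span_range_iff_exists_fun K).mp hmem
  have hli' : LinearIndependent K fun i => (g (s i) : K⟦X⟧) * y (s i) :=
    hli.comp _ e.symm.injective
  obtain ⟨hm, hle⟩ := WronskAux.core (fun i => y (s i)) (fun i => p (s i)) (fun i => q (s i))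
    (fun i => g (s i)) a (fun i => hode _) (fun i => hp _) (fun i => hq _) (fun i => hq0 _)
    (fun i => hg _) hli' S ha.symm hS0
  have hmn : m ≤ n := by simpa using Fintype.card_le_of_injective s hsinj
  refine hle.trans (add_le_add ?_ ?_)
  · have : ∑ i, (y (s i)).order = ∑ i ∈ Finset.univ.map ⟨s, hsinj⟩, (y i).order := by
      rw [Finset.sum_map]; rfl
    rw [this]
    exact Finset.sum_le_sum_of_subset (Finset.subset_univ _)
  · have h1 : m ^ 2 * d ≤ n ^ 2 * d := by gcongr
    exact_mod_cast (by omega)
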